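/- arXiv:1909.04244 — 3 statements merged into one kernel-verified Lean document; each statement's English description precedes it below -/
import Mathlib

section
/- Fix an integer Δ ≥ 3. Every ζ = (β, γ, λ) ∈ ℝ³ with β > 0, γ > 0, βγ > Δ/(Δ−2), and 0 ≤ λ < γ/(t^{Δ−1}·((Δ−2)βγ−Δ)) where t = max{1, β}, satisfies real contraction for Δ. -/
open scoped Classical
open Finset

noncomputable section

/-- The tree recursion function `F_{ζ,s}(x) = λ β^{s₁} γ^{−s₂} ∏ᵢ (βxᵢ+1)/(xᵢ+γ)` (real). -/
def FrecR (ζ : ℝ × ℝ × ℝ) (s : ℕ × ℕ × ℕ) (x : Fin s.2.2 → ℝ) : ℝ :=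
  ζ.2.2 * ζ.1 ^ s.1 * (ζ.2.1)⁻¹ ^ s.2.1 * ∏ i, (ζ.1 * x i + 1) / (x i + ζ.2.1)
/-- `ζ = (β,γ,λ) ∈ ℝ³` satisfies real contraction for `Δ`: there are a compact interval
`J = [a,b]` with `λ ∈ J`, `−γ ∉ J`, `−1 ∉ J`, and a real analytic `φ` on `J` with
nonvanishing derivative (with inverse `ψ` on `I = φ(J)`), such that `J` is invariant
under all recursion functions with `‖s‖₁ ≤ Δ−1`, the value `−1` is avoided for
`‖s‖₁ = Δ`, and the `1`-norm of the gradient of `φ ∘ F_{ζ,s} ∘ ψ` is at most `1 − η`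
on `I^k` for some `η > 0`. -/
def RealContraction (ζ : ℝ × ℝ × ℝ) (Δ : ℕ) : Prop :=
  ∃ (a b : ℝ) (φ ψ : ℝ → ℝ) (η : ℝ),
    a ≤ b ∧ ζ.2.2 ∈ Set.Icc a b ∧ -ζ.2.1 ∉ Set.Icc a b ∧ (-1:ℝ) ∉ Set.Icc a b ∧
    AnalyticOnNhd ℝ φ (Set.Icc a b) ∧
    (∀ x ∈ Set.Icc a b, deriv φ x ≠ 0) ∧
    (∀ x ∈ Set.Icc a b, ψ (φ x) = x) ∧
    (∀ y ∈ φ '' Set.Icc a b, φ (ψ y) = y) ∧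
    (∀ s : ℕ × ℕ × ℕ, s.1 + s.2.1 + s.2.2 ≤ Δ - 1 →
      ∀ x : Fin s.2.2 → ℝ, (∀ i, x i ∈ Set.Icc a b) → FrecR ζ s x ∈ Set.Icc a b) ∧
    (∀ s : ℕ × ℕ × ℕ, s.1 + s.2.1 + s.2.2 = Δ →
      ∀ x : Fin s.2.2 → ℝ, (∀ i, x i ∈ Set.Icc a b) → FrecR ζ s x ≠ -1) ∧
    0 < η ∧
    (∀ s : ℕ × ℕ × ℕ, s.1 + s.2.1 + s.2.2 ≤ Δ - 1 →
      ∀ x : Fin s.2.2 → ℝ, (∀ i, x i ∈ φ '' Set.Icc a b) →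
        ∑ i, |deriv (fun t => φ (FrecR ζ s fun j => ψ (Function.update x i t j))) (x i)|
          ≤ 1 - η)

theorem moebius_mem_Ioo {β γ x : ℝ} (hγ : 0 < γ) (hβγ : 1 < β * γ) (hx : 0 < x) :
    (β * x + 1) / (x + γ) ∈ Set.Ioo γ⁻¹ β := by
  have hxγ : 0 < x + γ := by positivity
  constructor
  · rw [lt_div_iff₀ hxγ, inv_mul_lt_iff₀ hγ]
    nlinarith
  · rw [div_lt_iff₀ hxγ]
    linarith

/-- On positive arguments the recursion function lies between `λ m ^ n` and `λ M ^ n`, where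
`m ≤ 1` is a lower bound and `M ≥ 1` an upper bound for all its factors. -/
theorem FrecR_mem_Icc {β γ lam m M : ℝ} {n : ℕ} (hγ : 0 < γ) (hβγ : 1 < β * γ) (hlam : 0 ≤ lam)
    (hm : 0 < m) (hm1 : m ≤ 1) (hmγ : m ≤ γ⁻¹) (hM1 : 1 ≤ M) (hβM : β ≤ M)
    (s : ℕ × ℕ × ℕ) (hs : s.1 + s.2.1 + s.2.2 ≤ n) (x : Fin s.2.2 → ℝ) (hx : ∀ i, 0 < x i) :
    FrecR (β, γ, lam) s x ∈ Set.Icc (lam * m ^ n) (lam * M ^ n) := by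
  have hγβ : γ⁻¹ < β := by rwa [inv_lt_iff_one_lt_mul₀ hγ]
  have hi : 0 < γ⁻¹ := inv_pos.2 hγ
  have hβ : 0 < β := hi.trans hγβ
  have hfac := fun i => moebius_mem_Ioo hγ hβγ (hx i)
  have hlow : m ^ s.2.2 ≤ ∏ i, (β * x i + 1) / (x i + γ) := by
    simpa using Finset.prod_le_prod (s := univ) (f := fun _ : Fin s.2.2 => m)
      (fun _ _ => hm.le) (fun i _ => hmγ.trans (hfac i).1.le)
  have hupp : ∏ i, (β * x i + 1) / (x i + γ) ≤ M ^ s.2.2 := by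
    simpa using Finset.prod_le_prod (s := univ) (g := fun _ : Fin s.2.2 => M)
      (fun i _ => (hi.trans (hfac i).1).le) (fun i _ => (hfac i).2.le.trans hβM)
  have hprod : 0 ≤ ∏ i, (β * x i + 1) / (x i + γ) := (pow_pos hm _).le.trans hlow
  have hF : FrecR (β, γ, lam) s x
      = lam * (β ^ s.1 * γ⁻¹ ^ s.2.1 * ∏ i, (β * x i + 1) / (x i + γ)) := by
    simp only [FrecR]
    ring
  rw [hF]
  constructor
  · refine mul_le_mul_of_nonneg_left ?_ hlam
    calc m ^ n ≤ m ^ (s.1 + s.2.1 + s.2.2) := pow_le_pow_of_le_one hm.le hm1 hs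
      _ = m ^ s.1 * m ^ s.2.1 * m ^ s.2.2 := by rw [pow_add, pow_add]
      _ ≤ _ := by
        gcongr
        exact hmγ.trans hγβ.le
  · refine mul_le_mul_of_nonneg_left ?_ hlam
    calc _ ≤ M ^ s.1 * M ^ s.2.1 * M ^ s.2.2 := by
          gcongr
          exact hγβ.le.trans hβM
      _ = M ^ (s.1 + s.2.1 + s.2.2) := by rw [pow_add, pow_add]
      _ ≤ M ^ n := pow_le_pow_right₀ hM1 hs

/-- The partial derivatives of the recursion function in logarithmic coordinates. -/
theorem hasDerivAt_log_FrecR_exp {β γ lam : ℝ} (hβ : 0 < β) (hγ : 0 < γ) (hlam : 0 < lam)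
    (s : ℕ × ℕ × ℕ) (x : Fin s.2.2 → ℝ) (i : Fin s.2.2) :
    HasDerivAt
      (fun t => Real.log (FrecR (β, γ, lam) s fun j => Real.exp (Function.update x i t j)))
      (Real.exp (x i) * (β * γ - 1) / ((β * Real.exp (x i) + 1) * (Real.exp (x i) + γ)))
      (x i) := by
  set h : ℝ → ℝ := fun t => (β * Real.exp t + 1) / (Real.exp t + γ)
  have hpos : ∀ t, 0 < h t := fun t => by positivity
  set C : ℝ := lam * β ^ s.1 * γ⁻¹ ^ s.2.1 * ∏ j ∈ univ.erase i, h (x j)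
  have hC : 0 < C := by
    have := Finset.prod_pos fun j (_ : j ∈ univ.erase i) => hpos (x j)
    positivity
  have hsplit : (fun t => Real.log
      (FrecR (β, γ, lam) s fun j => Real.exp (Function.update x i t j))) =
      fun t => Real.log C
        + (Real.log (β * Real.exp t + 1) - Real.log (Real.exp t + γ)) := by
    funext t
    have hprod : ∏ j, h (Function.update x i t j) = h t * ∏ j ∈ univ.erase i, h (x j) := by
      rw [← Finset.mul_prod_erase univ _ (mem_univ i), Function.update_self]
      congr 1
      refine Finset.prod_congr rfl fun j hj => ?_
      rw [Function.update_of_ne (Finset.ne_of_mem_erase hj)]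
    have hF : (FrecR (β, γ, lam) s fun j => Real.exp (Function.update x i t j)) = C * h t := by
      change lam * β ^ s.1 * γ⁻¹ ^ s.2.1 * ∏ j, h (Function.update x i t j) = _
      rw [hprod]
      ring
    rw [hF, Real.log_mul hC.ne' (hpos t).ne', Real.log_div (by positivity) (by positivity)]
  rw [hsplit]
  have hnum : β * Real.exp (x i) + 1 ≠ 0 := by positivity
  have hden : Real.exp (x i) + γ ≠ 0 := by positivity
  have hd := ((((Real.hasDerivAt_exp (x i)).const_mul β).add_const 1).log hnum).sub
    (((Real.hasDerivAt_exp (x i)).add_const γ).log hden) |>.const_add (Real.log C)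
  refine hd.congr_deriv ?_
  field_simp
  ring

/-- A quantitative bound on the logarithmic derivative of `x ↦ (β x + 1) / (x + γ)` on `[0, b]`. -/
theorem moebius_log_slope_le {β γ D x b : ℝ} (hβ : 0 < β) (hγ : 0 < γ)
    (hx : 0 ≤ x) (hxb : x ≤ b) (hc : 0 ≤ (D - 2) * (β * γ) - D)
    (hb : 0 ≤ γ - ((D - 2) * (β * γ) - D) * b) :
    (D - 1) * (x * (β * γ - 1) / ((β * x + 1) * (x + γ))) ≤
      1 - (γ - ((D - 2) * (β * γ) - D) * b) / ((β * b + 1) * (b + γ)) := by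
  have hb0 : 0 ≤ b := hx.trans hxb
  have hcx := mul_le_mul_of_nonneg_left hxb hc
  have hmono : (γ - ((D - 2) * (β * γ) - D) * b) / ((β * b + 1) * (b + γ)) ≤
      (β * x ^ 2 - ((D - 2) * (β * γ) - D) * x + γ) / ((β * x + 1) * (x + γ)) := by
    gcongr
    · nlinarith [mul_nonneg hβ.le (sq_nonneg x)]
    · nlinarith [mul_nonneg hβ.le (sq_nonneg x)]
  have heq : (D - 1) * (x * (β * γ - 1) / ((β * x + 1) * (x + γ))) =
      1 - (β * x ^ 2 - ((D - 2) * (β * γ) - D) * x + γ) / ((β * x + 1) * (x + γ)) := by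
    have h1 : β * x + 1 ≠ 0 := by positivity
    have h2 : x + γ ≠ 0 := by positivity
    field_simp
    ring
  linarith

theorem realContraction_of_lam_eq_zero {β γ : ℝ} {Δ : ℕ} (hγ : 0 < γ) :
    RealContraction (β, γ, 0) Δ := by
  refine ⟨0, 0, id, id, 1, le_rfl, by simp, by simp [hγ.ne'], by simp, analyticOnNhd_id,
    by simp, by simp, by simp, ?_, ?_, one_pos, ?_⟩ <;> simp [FrecR]

/-- For `Δ ≥ 3`, every `ζ = (β, γ, λ) ∈ ℝ³` with `β, γ > 0`,
`βγ > Δ/(Δ−2)`, and `0 ≤ λ < γ/(t^{Δ−1}·((Δ−2)βγ−Δ))` where `t = max{1, β}`,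
satisfies real contraction for `Δ`. -/
theorem S3_realContraction (Δ : ℕ) (hΔ : 3 ≤ Δ) (β γ lam : ℝ)
    (hβ : 0 < β) (hγ : 0 < γ)
    (hβγ : β * γ > (Δ:ℝ) / ((Δ:ℝ) - 2))
    (hlam0 : 0 ≤ lam)
    (hlam : lam < γ / ((max 1 β) ^ (Δ - 1) * (((Δ:ℝ) - 2) * (β * γ) - (Δ:ℝ)))) :
    RealContraction (β, γ, lam) Δ := by
  rcases hlam0.eq_or_lt with rfl | hlam0
  · exact realContraction_of_lam_eq_zero hγ
  have hD : (3 : ℝ) ≤ Δ := by exact_mod_cast hΔ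
  have hc : 0 < ((Δ : ℝ) - 2) * (β * γ) - Δ := by
    rw [gt_iff_lt, div_lt_iff₀ (by linarith)] at hβγ
    linarith
  have hβγ1 : 1 < β * γ := by
    refine lt_of_le_of_lt ?_ hβγ
    rw [one_le_div (by linarith)]
    linarith
  set M : ℝ := max 1 β
  set m : ℝ := min 1 γ⁻¹
  have hM1 : 1 ≤ M := le_max_left _ _
  have hm : 0 < m := lt_min one_pos (inv_pos.2 hγ)
  have hm1 : m ≤ 1 := min_le_left _ _
  have hM : 0 < M := one_pos.trans_le hM1
  set a : ℝ := lam * m ^ (Δ - 1)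
  set b : ℝ := lam * M ^ (Δ - 1)
  have ha : 0 < a := by positivity
  have hal : a ≤ lam := mul_le_of_le_one_right hlam0.le (pow_le_one₀ hm.le hm1)
  have hlb : lam ≤ b := le_mul_of_one_le_right hlam0.le (one_le_pow₀ hM1)
  have hgap : 0 < γ - (((Δ : ℝ) - 2) * (β * γ) - Δ) * b := by
    rw [lt_div_iff₀ (by positivity)] at hlam
    simp only [b]
    linarith
  have hpos : ∀ x ∈ Set.Icc a b, 0 < x := fun x hx => ha.trans_le hx.1
  have hbound : ∀ n : ℕ, ∀ s : ℕ × ℕ × ℕ, s.1 + s.2.1 + s.2.2 ≤ n →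
      ∀ x : Fin s.2.2 → ℝ, (∀ i, x i ∈ Set.Icc a b) →
        FrecR (β, γ, lam) s x ∈ Set.Icc (lam * m ^ n) (lam * M ^ n) :=
    fun n s hs x hx => FrecR_mem_Icc hγ hβγ1 hlam0.le hm hm1 (min_le_right _ _) hM1
      (le_max_right _ _) s hs x fun i => hpos _ (hx i)
  refine ⟨a, b, Real.log, Real.exp,
    (γ - (((Δ : ℝ) - 2) * (β * γ) - Δ) * b) / ((β * b + 1) * (b + γ)), hal.trans hlb,
    ⟨hal, hlb⟩, fun h => by linarith [hpos _ h], fun h => by linarith [hpos _ h],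
    fun x hx => analyticAt_log (hpos x hx), fun x hx => ?_,
    fun x hx => Real.exp_log (hpos x hx), fun y _ => Real.log_exp y, hbound (Δ - 1), ?_,
    by positivity, ?_⟩
  · rw [Real.deriv_log]
    exact inv_ne_zero (hpos x hx).ne'
  · intro s hs x hx h
    have hlow := (hbound Δ s hs.le x hx).1
    have : 0 < lam * m ^ Δ := by positivity
    linarith
  · intro s hs x hx
    set η := (γ - (((Δ : ℝ) - 2) * (β * γ) - Δ) * b) / ((β * b + 1) * (b + γ))
    have hD1 : 0 < (Δ : ℝ) - 1 := by linarith
    have hterm : ∀ i, |deriv (fun t => Real.log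
        (FrecR (β, γ, lam) s fun j => Real.exp (Function.update x i t j))) (x i)|
          ≤ (1 - η) / (Δ - 1) := by
      intro i
      obtain ⟨y, hy, hyx⟩ := hx i
      have hy0 := hpos y hy
      have hexp : Real.exp (x i) = y := by rw [← hyx, Real.exp_log hy0]
      have hβγ0 : 0 < β * γ - 1 := by linarith
      rw [(hasDerivAt_log_FrecR_exp hβ hγ hlam0 s x i).deriv, hexp, abs_of_nonneg (by positivity),
        le_div_iff₀' hD1]
      exact moebius_log_slope_le hβ hγ hy0.le hy.2 hc.le hgap.le
    have hη : 0 ≤ 1 - η := by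
      have h0 := moebius_log_slope_le hβ hγ le_rfl (hlam0.le.trans hlb) hc.le hgap.le
      simpa using h0
    have hk : (s.2.2 : ℝ) ≤ Δ - 1 := by
      have : s.2.2 + 1 ≤ Δ := by omega
      have : (s.2.2 : ℝ) + 1 ≤ Δ := by exact_mod_cast this
      linarith
    calc _ ≤ ∑ _i : Fin s.2.2, (1 - η) / ((Δ : ℝ) - 1) := Finset.sum_le_sum fun i _ => hterm i
      _ = s.2.2 * ((1 - η) / (Δ - 1)) := by simp
      _ ≤ (Δ - 1) * ((1 - η) / (Δ - 1)) := by gcongr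
      _ = 1 - η := by field_simp
end
end

section
/- Let Δ ≥ 3 be an integer and let ζ = (β, γ, λ) with β ≥ 0, γ > 0, λ > 0, βγ < 1 be up-to-Δ unique. For an integer 1 ≤ d ≤ Δ−1 let f_d(x) = λ·((βx+1)/(x+γ))^d, let x̂_d be the unique positive fixed point of f_d, and define h_d(x) = d·(1−βγ)·√(x/((βx+1)(x+γ)))·√(f_d(x)/((β·f_d(x)+1)·(f_d(x)+γ))) for x > 0. Then for all x > 0, h_d(x) ≤ √(d·(1−βγ)·x̂_d/((β·x̂_d+1)·(x̂_d+γ))); in particular, with c as in the up-to-Δ uniqueness condition, h_d(x) ≤ √c for all x > 0. -/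
noncomputable section

/-- The function `f_d(x) = λ((βx+1)/(x+γ))^d`. -/
def fd (β γ lam : ℝ) (d : ℕ) (x : ℝ) : ℝ := lam * ((β * x + 1) / (x + γ)) ^ d

/-- The function `h_d` from the correlation-decay analysis. -/
def hfun (β γ lam : ℝ) (d : ℕ) (x : ℝ) : ℝ :=
  (d : ℝ) * (1 - β * γ) * Real.sqrt (x / ((β * x + 1) * (x + γ))) *
    Real.sqrt (fd β γ lam d x /
      ((β * fd β γ lam d x + 1) * (fd β γ lam d x + γ)))

/-- `|x f_d'(x) / f_d(x)|` when `k = d(1-βγ)`. -/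
def logSlope (β γ k y : ℝ) : ℝ := k * y / ((β * y + 1) * (y + γ))

/-- The logarithmic derivative `y ↦ y r'(y) / r(y)` of `r = logSlope β γ k`. -/
def elasticity (β γ y : ℝ) : ℝ := (γ - β * y ^ 2) / ((β * y + 1) * (y + γ))

section

variable {β γ lam k : ℝ} {d : ℕ} {x y : ℝ}

lemma logSlope_pos (hβ : 0 ≤ β) (hγ : 0 < γ) (hk : 0 < k) (hy : 0 < y) :
    0 < logSlope β γ k y := by
  unfold logSlope; positivity

lemma fd_pos (hβ : 0 ≤ β) (hγ : 0 < γ) (hlam : 0 < lam) (hx : 0 < x) :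
    0 < fd β γ lam d x := by
  unfold fd; positivity

lemma fd_lt_fd (hβ : 0 ≤ β) (hγ : 0 < γ) (hlam : 0 < lam) (hβγ : β * γ < 1) (hd : 1 ≤ d)
    (hx : 0 < x) (hxy : x < y) : fd β γ lam d y < fd β γ lam d x := by
  have hy : 0 < y := hx.trans hxy
  unfold fd
  refine mul_lt_mul_of_pos_left (pow_lt_pow_left₀ ?_ (by positivity) (by omega)) hlam
  rw [div_lt_div_iff₀ (by positivity) (by positivity)]
  nlinarith [mul_pos (sub_pos.2 hxy) (sub_pos.2 hβγ)]

lemma elasticity_anti (hβ : 0 ≤ β) (hγ : 0 < γ) (hx : 0 < x) (hxy : x ≤ y) :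
    elasticity β γ y ≤ elasticity β γ x := by
  have hy : 0 < y := hx.trans_le hxy
  have key : ∀ z : ℝ, 0 < z → elasticity β γ z = 1 / (β * z + 1) + γ / (z + γ) - 1 := by
    intro z hz
    have h1 : β * z + 1 ≠ 0 := by positivity
    have h2 : z + γ ≠ 0 := by positivity
    unfold elasticity
    field_simp
    ring
  rw [key x hx, key y hy]
  gcongr

lemma elasticity_pos_iff (hβ : 0 ≤ β) (hγ : 0 < γ) (hy : 0 < y) :
    0 < elasticity β γ y ↔ 0 < γ - β * y ^ 2 := by
  unfold elasticity
  exact div_pos_iff_of_pos_right (by positivity)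

lemma logSlope_mono (hβ : 0 ≤ β) (hγ : 0 < γ) (hk : 0 < k) (hx : 0 < x) (hxy : x ≤ y)
    (h : β * y ^ 2 ≤ γ) : logSlope β γ k x ≤ logSlope β γ k y := by
  have hy : 0 < y := hx.trans_le hxy
  unfold logSlope
  rw [div_le_div_iff₀ (by positivity) (by positivity)]
  have h1 : β * (x * y) ≤ γ := by
    refine le_trans ?_ h
    rw [sq]
    gcongr
  have := mul_nonneg hk.le (mul_nonneg (sub_nonneg.2 hxy) (sub_nonneg.2 h1))
  linarith

lemma hasDerivAt_logSlope (hβ : 0 ≤ β) (hγ : 0 < γ) (hy : 0 < y) :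
    HasDerivAt (logSlope β γ k) (logSlope β γ k y * elasticity β γ y / y) y := by
  have h1 : β * y + 1 ≠ 0 := by positivity
  have h2 : y + γ ≠ 0 := by positivity
  have h := ((hasDerivAt_id y).const_mul k).div
    ((((hasDerivAt_id y).const_mul β).add_const 1).mul ((hasDerivAt_id y).add_const γ))
    (mul_ne_zero h1 h2)
  refine h.congr_deriv ?_
  simp only [logSlope, elasticity, id, Pi.mul_apply]
  field_simp
  ring

lemma hasDerivAt_fd (hβ : 0 ≤ β) (hγ : 0 < γ) (hd : 1 ≤ d) (hx : 0 < x) :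
    HasDerivAt (fd β γ lam d)
      (-(logSlope β γ (d * (1 - β * γ)) x * fd β γ lam d x / x)) x := by
  have h1 : β * x + 1 ≠ 0 := by positivity
  have h2 : x + γ ≠ 0 := by positivity
  have h := ((((((hasDerivAt_id x).const_mul β).add_const 1).div
    ((hasDerivAt_id x).add_const γ) h2).pow d).const_mul lam)
  refine h.congr_deriv ?_
  obtain ⟨n, rfl⟩ := Nat.exists_eq_add_of_le' hd
  simp only [logSlope, fd, id, Pi.div_apply, Nat.add_sub_cancel, pow_succ]
  field_simp
  ring

lemma hasDerivAt_logSlope_mul_logSlope_fd (hβ : 0 ≤ β) (hγ : 0 < γ) (hlam : 0 < lam)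
    (hd : 1 ≤ d) (hk : k = d * (1 - β * γ)) (hx : 0 < x) :
    HasDerivAt (fun t => logSlope β γ k t * logSlope β γ k (fd β γ lam d t))
      (logSlope β γ k x * logSlope β γ k (fd β γ lam d x) / x *
        (elasticity β γ x - logSlope β γ k x * elasticity β γ (fd β γ lam d x))) x := by
  have hf : 0 < fd β γ lam d x := fd_pos hβ hγ hlam hx
  have h := (hasDerivAt_logSlope (k := k) hβ hγ hx).mul
    ((hasDerivAt_logSlope (k := k) hβ hγ hf).comp x (hasDerivAt_fd hβ hγ hd hx))
  refine h.congr_deriv ?_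
  rw [← hk]
  simp only [Function.comp]
  field_simp
  ring

end

/-- The derivative has the expected sign in any direction along which `x` is maximal. -/
lemma HasDerivAt.mul_sub_nonpos_of_isMaxOn_segment {f : ℝ → ℝ} {f' x y : ℝ}
    (hf : HasDerivAt f f' x) (hmax : IsMaxOn f (segment ℝ x y) x) : (y - x) * f' ≤ 0 := by
  have h := hmax.localize.hasFDerivWithinAt_nonpos hf.hasFDerivAt.hasFDerivWithinAt
    (sub_mem_posTangentConeAt_of_segment_subset subset_rfl)
  simpa using h

lemma logSlope_mul_logSlope_fd_le_of_sq_le {β γ lam k : ℝ} {d : ℕ} (hβ : 0 ≤ β) (hγ : 0 < γ)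
    (hlam : 0 < lam) (hβγ : β * γ < 1) (hd : 1 ≤ d) (hk : k = d * (1 - β * γ))
    {z : ℝ} (hz : 0 < z) (hfix : fd β γ lam d z = z) (hlt : logSlope β γ k z < 1)
    (hsq : β * z ^ 2 ≤ γ) {x : ℝ} (hx : 0 < x) :
    logSlope β γ k x * logSlope β γ k (fd β γ lam d x) ≤ logSlope β γ k z := by
  have hk0 : 0 < k := by
    rw [hk]
    exact mul_pos (by exact_mod_cast hd) (sub_pos.2 hβγ)
  set H : ℝ → ℝ := fun t => logSlope β γ k t * logSlope β γ k (fd β γ lam d t) with hH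
  have hpos : ∀ t ∈ Set.uIcc z x, 0 < t := fun t ht => (lt_min hz hx).trans_le ht.1
  have hderiv := fun t (ht : 0 < t) =>
    hasDerivAt_logSlope_mul_logSlope_fd hβ hγ hlam hd hk ht
  obtain ⟨w, hw, hmax⟩ := isCompact_uIcc.exists_isMaxOn (f := H) Set.nonempty_uIcc
    (fun t ht => (hderiv t (hpos t ht)).continuousAt.continuousWithinAt)
  have hw0 := hpos w hw
  have hf0 : 0 < fd β γ lam d w := fd_pos hβ hγ hlam hw0
  refine (hmax Set.right_mem_uIcc).trans ?_
  have hseg : IsMaxOn H (segment ℝ w z) w := by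
    rw [segment_eq_uIcc]
    exact hmax.on_subset (Set.uIcc_subset_uIcc hw Set.left_mem_uIcc)
  have hcrit := (hderiv w hw0).mul_sub_nonpos_of_isMaxOn_segment hseg
  have hrw := logSlope_pos hβ hγ hk0 hw0
  have hrf := logSlope_pos hβ hγ hk0 hf0
  have hfactor : 0 < logSlope β γ k w * logSlope β γ k (fd β γ lam d w) / w := by positivity
  rcases lt_trichotomy w z with hwz | rfl | hzw
  · exfalso
    have hsqw : 0 < γ - β * w ^ 2 := by
      rcases hβ.eq_or_lt with rfl | hβ'
      · simpa using hγ
      · have : β * w ^ 2 < β * z ^ 2 := by gcongr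
        linarith
    have hew := (elasticity_pos_iff hβ hγ hw0).2 hsqw
    have hle : elasticity β γ w ≤
        logSlope β γ k w * elasticity β γ (fd β γ lam d w) := by
      by_contra! hcon
      exact absurd hcrit
        (not_le.2 (mul_pos (sub_pos.2 hwz) (mul_pos hfactor (sub_pos.2 hcon))))
    have hwf : w ≤ fd β γ lam d w := by
      have := fd_lt_fd hβ hγ hlam hβγ hd hw0 hwz
      rw [hfix] at this
      exact (hwz.trans this).le
    have hanti := elasticity_anti hβ hγ hw0 hwf
    have hmono := logSlope_mono hβ hγ hk0 hw0 hwz.le hsq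
    nlinarith
  · simp only [hH, hfix]
    exact mul_le_of_le_one_left hrw.le hlt.le
  · have hle : logSlope β γ k w * elasticity β γ (fd β γ lam d w) ≤ elasticity β γ w := by
      by_contra! hcon
      exact absurd hcrit (not_le.2 (mul_pos_of_neg_of_neg (sub_neg.2 hzw)
        (mul_neg_of_pos_of_neg hfactor (sub_neg.2 hcon))))
    have hfz : fd β γ lam d w < z := by
      have := fd_lt_fd hβ hγ hlam hβγ hd hz hzw
      rwa [hfix] at this
    have hsqf : 0 < γ - β * fd β γ lam d w ^ 2 := by
      rcases hβ.eq_or_lt with rfl | hβ'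
      · simpa using hγ
      · have : β * fd β γ lam d w ^ 2 < β * z ^ 2 := by gcongr
        linarith
    have hef := (elasticity_pos_iff hβ hγ hf0).2 hsqf
    have hew : 0 < elasticity β γ w := (mul_pos hrw hef).trans_le hle
    have hanti := elasticity_anti hβ hγ hz hzw.le
    have hsqz := (elasticity_pos_iff hβ hγ hz).1 (hew.trans_le hanti)
    have hsplit : ∀ t : ℝ, 0 < γ - β * t ^ 2 →
        logSlope β γ k t = elasticity β γ t * (k * t / (γ - β * t ^ 2)) := by
      intro t ht
      unfold logSlope elasticity
      rw [div_mul_div_comm, mul_comm _ (γ - β * t ^ 2),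
        mul_div_mul_left _ _ ht.ne']
    calc H w = logSlope β γ k w * elasticity β γ (fd β γ lam d w) *
          (k * fd β γ lam d w / (γ - β * fd β γ lam d w ^ 2)) := by
          simp only [hH]
          rw [hsplit _ hsqf, mul_assoc]
      _ ≤ elasticity β γ z * (k * z / (γ - β * z ^ 2)) := by
          have := hew.le.trans hanti
          have := hle.trans hanti
          gcongr
      _ = logSlope β γ k z := (hsplit z hsqz).symm

lemma logSlope_inv {β γ k x : ℝ} (hβ : 0 ≤ β) (hγ : 0 < γ) (hx : 0 < x) :
    logSlope γ β k x⁻¹ = logSlope β γ k x := by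
  have h1 : β * x + 1 ≠ 0 := by positivity
  have h2 : x + γ ≠ 0 := by positivity
  unfold logSlope
  rw [div_eq_div_iff (by positivity) (by positivity)]
  field_simp
  ring

lemma fd_inv {β γ lam x : ℝ} {d : ℕ} (hx : 0 < x) :
    fd γ β lam⁻¹ d x⁻¹ = (fd β γ lam d x)⁻¹ := by
  unfold fd
  rw [mul_inv, ← inv_pow, inv_div, ← mul_div_mul_right (γ * x⁻¹ + 1) (x⁻¹ + β) hx.ne']
  congr 3 <;> field_simp <;> ring

lemma logSlope_mul_logSlope_fd_le {β γ lam k : ℝ} {d : ℕ} (hβ : 0 ≤ β) (hγ : 0 < γ)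
    (hlam : 0 < lam) (hβγ : β * γ < 1) (hd : 1 ≤ d) (hk : k = d * (1 - β * γ))
    {z : ℝ} (hz : 0 < z) (hfix : fd β γ lam d z = z) (hlt : logSlope β γ k z < 1)
    {x : ℝ} (hx : 0 < x) :
    logSlope β γ k x * logSlope β γ k (fd β γ lam d x) ≤ logSlope β γ k z := by
  rcases le_or_gt (β * z ^ 2) γ with hsq | hsq
  · exact logSlope_mul_logSlope_fd_le_of_sq_le hβ hγ hlam hβγ hd hk hz hfix hlt hsq hx
  · have hβ' : 0 < β := by
      refine hβ.lt_of_ne fun h => ?_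
      rw [← h, zero_mul] at hsq
      exact hsq.not_gt hγ
    have h := logSlope_mul_logSlope_fd_le_of_sq_le (k := k) (d := d) hγ.le hβ' (inv_pos.2 hlam)
      (by rwa [mul_comm]) hd (by rw [hk, mul_comm β]) (inv_pos.2 hz)
      (by rw [fd_inv hz, hfix]) (by rwa [logSlope_inv hβ hγ hz])
      (by
        rw [inv_pow, ← div_eq_mul_inv, div_le_iff₀ (by positivity)]
        exact hsq.le) (inv_pos.2 hx)
    rwa [fd_inv hx, logSlope_inv hβ hγ hx, logSlope_inv hβ hγ hz,
      logSlope_inv hβ hγ (fd_pos hβ hγ hlam hx)] at h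

lemma hfun_eq_sqrt {β γ lam x : ℝ} {d : ℕ} (hβ : 0 ≤ β) (hγ : 0 < γ) (hβγ : β * γ < 1)
    (hx : 0 < x) :
    hfun β γ lam d x = Real.sqrt (logSlope β γ (d * (1 - β * γ)) x *
      logSlope β γ (d * (1 - β * γ)) (fd β γ lam d x)) := by
  have hk : 0 ≤ (d : ℝ) * (1 - β * γ) := mul_nonneg d.cast_nonneg (sub_nonneg.2 hβγ.le)
  have hu : 0 ≤ x / ((β * x + 1) * (x + γ)) := by positivity
  unfold hfun logSlope
  rw [mul_div_assoc, mul_div_assoc, mul_mul_mul_comm, Real.sqrt_mul (mul_self_nonneg _),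
    Real.sqrt_mul_self hk, Real.sqrt_mul hu, mul_assoc]

/-- Let `Δ ≥ 3`, `ζ = (β,γ,λ)` with `β ≥ 0`, `γ > 0`, `λ > 0`,
`βγ < 1`, up-to-`Δ` unique with constant `0 < c < 1`. For `1 ≤ d ≤ Δ−1` with positive
fixed point `x̂_d` of `f_d`, for all `x > 0`:
`h_d(x) ≤ √(d(1−βγ)x̂_d/((βx̂_d+1)(x̂_d+γ)))`, and in particular `h_d(x) ≤ √c`. -/
theorem hfun_bound (Δ : ℕ) (hΔ : 3 ≤ Δ) (β γ lam : ℝ)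
    (hβ : 0 ≤ β) (hγ : 0 < γ) (hlam : 0 < lam) (hβγ : β * γ < 1)
    (c : ℝ) (hc0 : 0 < c) (hc1 : c < 1)
    (huniq : ∀ d : ℕ, 1 ≤ d → d ≤ Δ - 1 → ∀ y : ℝ, 0 < y → fd β γ lam d y = y →
      (d : ℝ) * (1 - β * γ) * y / ((β * y + 1) * (y + γ)) ≤ c)
    (d : ℕ) (hd1 : 1 ≤ d) (hdΔ : d ≤ Δ - 1)
    (xhat : ℝ) (hxhat : 0 < xhat) (hfix : fd β γ lam d xhat = xhat) :
    ∀ x : ℝ, 0 < x →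
      hfun β γ lam d x ≤
        Real.sqrt ((d : ℝ) * (1 - β * γ) * xhat / ((β * xhat + 1) * (xhat + γ))) ∧
      hfun β γ lam d x ≤ Real.sqrt c := by
  intro x hx
  have hle : logSlope β γ (d * (1 - β * γ)) xhat ≤ c := huniq d hd1 hdΔ xhat hxhat hfix
  have h := logSlope_mul_logSlope_fd_le hβ hγ hlam hβγ hd1 rfl hxhat hfix (hle.trans_lt hc1) hx
  rw [hfun_eq_sqrt hβ hγ hβγ hx]
  exact ⟨Real.sqrt_le_sqrt h, Real.sqrt_le_sqrt (h.trans hle)⟩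
end
end

section
/- Let β ≥ 0, γ > 0, λ > 0 be real with βγ < 1, let s = (s₁, s₂, k) ∈ ℕ³ with k ≥ 1, and set d = s₁ + s₂ + k. Define for x = (x₁,…,x_k) ∈ (0,∞)^k: H_{ζ,s}(x) = (1−βγ)·√(F_{ζ,s}(x)/((β·F_{ζ,s}(x)+1)·(F_{ζ,s}(x)+γ)))·Σ_{i=1}^{k} √(x_i/((βx_i+1)(x_i+γ))), where F_{ζ,s}(x) = λ·β^{s₁}·γ^{−s₂}·∏_{i=1}^{k}(βx_i+1)/(x_i+γ), and define h_d(y) = d·(1−βγ)·√(y/((βy+1)(y+γ)))·√(f_d(y)/((β·f_d(y)+1)·(f_d(y)+γ))) with f_d(y) = λ·((βy+1)/(y+γ))^d. Then for every x ∈ (0,∞)^k there exists x̂ > 0 such that H_{ζ,s}(x) ≤ h_d(x̂). -/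
open Finset

noncomputable section

/-- The gradient 1-norm `H_{ζ,s}` of the potential-transformed recursion function. -/
def Hfun (β γ lam : ℝ) (s : ℕ × ℕ × ℕ) (x : Fin s.2.2 → ℝ) : ℝ :=
  (1 - β * γ) *
    Real.sqrt (FrecR (β, γ, lam) s x /
      ((β * FrecR (β, γ, lam) s x + 1) * (FrecR (β, γ, lam) s x + γ))) *
    ∑ i, Real.sqrt (x i / ((β * x i + 1) * (x i + γ)))

/-- AM–GM, for a positive number `g` whose power is the product of the `z i`. -/
lemma card_mul_le_sum_of_pow_eq_prod {ι : Type*} [Fintype ι] {z : ι → ℝ} {g : ℝ}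
    (hz : ∀ i, 0 < z i) (hg : 0 < g) (h : g ^ Fintype.card ι = ∏ i, z i) :
    Fintype.card ι * g ≤ ∑ i, z i := by
  have hlog : ∑ i, Real.log (z i / g) = 0 := by
    rw [← Real.log_prod fun i _ => (div_pos (hz i) hg).ne', Finset.prod_div_distrib, ← h]
    simp [hg.ne']
  have hsum : ∑ i, (Real.log (z i / g) + 1) ≤ ∑ i, z i / g :=
    Finset.sum_le_sum fun i _ => by
      linarith [Real.log_le_sub_one_of_pos (div_pos (hz i) hg)]
  rw [Finset.sum_add_distrib, hlog, ← Finset.sum_div, le_div_iff₀ hg] at hsum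
  simpa using hsum

/-- Jensen's inequality for the square root, as an instance of Cauchy–Schwarz. -/
lemma sum_sqrt_le_card_mul_sqrt {ι : Type*} [Fintype ι] {a : ι → ℝ} {m : ℝ}
    (ha : ∀ i, 0 ≤ a i) (h : ∑ i, a i ≤ Fintype.card ι * m) :
    ∑ i, √(a i) ≤ Fintype.card ι * √m := by
  have hcs := sq_sum_le_card_mul_sum_sq (s := Finset.univ) (f := fun i => √(a i))
  simp only [Real.sq_sqrt (ha _), Finset.card_univ] at hcs
  have hn : (0 : ℝ) ≤ Fintype.card ι := Nat.cast_nonneg _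
  calc ∑ i, √(a i) ≤ √((Fintype.card ι : ℝ) ^ 2 * m) := by
        refine Real.le_sqrt_of_sq_le (hcs.trans ?_)
        rw [sq, mul_assoc]
        exact mul_le_mul_of_nonneg_left h hn
    _ = Fintype.card ι * √m := by rw [Real.sqrt_mul (sq_nonneg _), Real.sqrt_sq hn]

/-- The quantity `x / ((βx+1)(x+γ))` in terms of `z = (βx+1)/(x+γ)`. -/
def ratioWeight (β γ z : ℝ) : ℝ := (1 + β * γ - γ * z - β * z⁻¹) / (1 - β * γ) ^ 2

lemma ratioWeight_ratio {β γ x : ℝ} (hβ : 0 ≤ β) (hγ : 0 < γ) (hβγ : β * γ < 1) (hx : 0 < x) :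
    ratioWeight β γ ((β * x + 1) / (x + γ)) = x / ((β * x + 1) * (x + γ)) := by
  have h₁ : β * x + 1 ≠ 0 := by positivity
  have h₂ : x + γ ≠ 0 := by positivity
  have h₃ : 1 - β * γ ≠ 0 := by linarith
  unfold ratioWeight
  field_simp
  ring

lemma sum_ratioWeight_le {ι : Type*} [Fintype ι] {β γ g : ℝ} {z : ι → ℝ} (hβ : 0 ≤ β)
    (hγ : 0 < γ) (hz : ∀ i, 0 < z i) (hg : 0 < g)
    (h : g ^ Fintype.card ι = ∏ i, z i) :
    ∑ i, ratioWeight β γ (z i) ≤ Fintype.card ι * ratioWeight β γ g := by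
  have h₁ := card_mul_le_sum_of_pow_eq_prod hz hg h
  have h₂ := card_mul_le_sum_of_pow_eq_prod (fun i => inv_pos.2 (hz i)) (inv_pos.2 hg)
    (by rw [inv_pow, h, Finset.prod_inv_distrib])
  simp only [ratioWeight, ← Finset.sum_div, Finset.sum_sub_distrib, ← Finset.mul_sum,
    Finset.sum_const, Finset.card_univ, nsmul_eq_mul]
  rw [← mul_div_assoc]
  gcongr
  nlinarith [mul_le_mul_of_nonneg_left h₁ hγ.le, mul_le_mul_of_nonneg_left h₂ hβ]

lemma exists_ratio_eq {β γ g : ℝ} (hγ : 0 < γ) (hβγ : β * γ < 1) (hg : 0 < g)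
    (h : 0 < ratioWeight β γ g) : ∃ y : ℝ, 0 < y ∧ (β * y + 1) / (y + γ) = g := by
  have hd : 0 < (1 - β * γ) ^ 2 := pow_pos (by linarith) 2
  have hnum : 0 < 1 + β * γ - γ * g - β * g⁻¹ := (div_pos_iff_of_pos_right hd).1 h
  have hprod : 0 < (1 - γ * g) * (g - β) := by
    have := mul_pos hnum hg
    field_simp at this
    linarith
  have hpos : 0 < 1 - γ * g ∧ 0 < g - β := by
    rcases mul_pos_iff.1 hprod with h | h
    · exact h
    · nlinarith [mul_pos hγ (neg_pos.2 h.2)]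
  refine ⟨(1 - γ * g) / (g - β), div_pos hpos.1 hpos.2, ?_⟩
  have h₁ := hpos.2.ne'
  have h₂ : 1 - β * γ ≠ 0 := by linarith
  have h₃ : (1 - γ * g) / (g - β) + γ = (1 - β * γ) / (g - β) := by
    field_simp
    ring
  rw [h₃]
  field_simp
  ring

/-- symmetrization step. Let `β ≥ 0`, `γ > 0`, `λ > 0` with
`βγ < 1`, and `s = (s₁, s₂, k)` with `k ≥ 1`, `d = s₁ + s₂ + k`. Then for every
`x ∈ (0,∞)^k` there exists `x̂ > 0` with `H_{ζ,s}(x) ≤ h_d(x̂)`. -/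
theorem symmetrization (β γ lam : ℝ) (hβ : 0 ≤ β) (hγ : 0 < γ) (hlam : 0 < lam)
    (hβγ : β * γ < 1) (s : ℕ × ℕ × ℕ) (hk : 1 ≤ s.2.2)
    (x : Fin s.2.2 → ℝ) (hx : ∀ i, 0 < x i) :
    ∃ xhat : ℝ, 0 < xhat ∧
      Hfun β γ lam s x ≤ hfun β γ lam (s.1 + s.2.1 + s.2.2) xhat := by
  have hc : 0 < 1 - β * γ := by linarith
  by_cases hzero : β = 0 ∧ s.1 ≠ 0
  · refine ⟨1, one_pos, ?_⟩
    have hF : FrecR (β, γ, lam) s x = 0 := by simp [FrecR, hzero.1, hzero.2]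
    have : 0 ≤ hfun β γ lam (s.1 + s.2.1 + s.2.2) 1 := by
      unfold hfun
      positivity
    simpa [Hfun, hF] using this
  let z : (Fin s.1 ⊕ Fin s.2.1) ⊕ Fin s.2.2 → ℝ :=
    Sum.elim (Sum.elim (fun _ => β) fun _ => γ⁻¹) fun i => (β * x i + 1) / (x i + γ)
  have hcard : Fintype.card ((Fin s.1 ⊕ Fin s.2.1) ⊕ Fin s.2.2) = s.1 + s.2.1 + s.2.2 := by simp
  have hd : s.1 + s.2.1 + s.2.2 ≠ 0 := by omega
  have hz : ∀ i, 0 < z i := by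
    rintro ((i | i) | i)
    · exact hβ.lt_of_ne fun h => hzero ⟨h.symm, i.pos.ne'⟩
    · exact inv_pos.2 hγ
    · have := hx i
      simp only [z, Sum.elim_inr]
      positivity
  have hleft : ∀ i, ratioWeight β γ (z (Sum.inl i)) = 0 := by
    rintro (i | i)
    · have : β ≠ 0 := (hz (Sum.inl (Sum.inl i))).ne'
      simp [z, ratioWeight, this, mul_comm β γ]
    · simp [z, ratioWeight, hγ.ne']
  have hright : ∀ i, ratioWeight β γ (z (Sum.inr i)) = x i / ((β * x i + 1) * (x i + γ)) :=
    fun i => ratioWeight_ratio hβ hγ hβγ (hx i)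
  have hrpos : ∀ i, 0 < x i / ((β * x i + 1) * (x i + γ)) := fun i => by
    have := hx i
    positivity
  have hprod : 0 < ∏ i, z i := Finset.prod_pos fun i _ => hz i
  obtain ⟨g, hg, hgpow⟩ : ∃ g : ℝ, 0 < g ∧ g ^ (s.1 + s.2.1 + s.2.2) = ∏ i, z i :=
    ⟨_, Real.rpow_pos_of_pos hprod _, Real.rpow_inv_natCast_pow hprod.le hd⟩
  have hsum := sum_ratioWeight_le hβ hγ hz hg (by rw [hcard, hgpow])
  have hsqrt := sum_sqrt_le_card_mul_sqrt (a := fun i => ratioWeight β γ (z i))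
    (by
      rintro (i | i)
      · exact (hleft i).ge
      · exact (hrpos i).le.trans_eq (hright i).symm) hsum
  have hgpos : 0 < ratioWeight β γ g := by
    rw [Fintype.sum_sum_type] at hsum
    simp only [hleft, hright, Finset.sum_const_zero, zero_add] at hsum
    have : Nonempty (Fin s.2.2) := ⟨⟨0, hk⟩⟩
    exact pos_of_mul_pos_right
      ((Finset.sum_pos (fun i _ => hrpos i) Finset.univ_nonempty).trans_le hsum)
      (Nat.cast_nonneg _)
  rw [Fintype.sum_sum_type] at hsqrt
  simp only [hleft, hright, Real.sqrt_zero, Finset.sum_const_zero, zero_add, hcard] at hsqrt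
  obtain ⟨y, hy, rfl⟩ := exists_ratio_eq hγ hβγ hg hgpos
  rw [ratioWeight_ratio hβ hγ hβγ hy] at hsqrt
  have hF : FrecR (β, γ, lam) s x = fd β γ lam (s.1 + s.2.1 + s.2.2) y := by
    rw [fd, hgpow, Fintype.prod_sum_type, Fintype.prod_sum_type]
    simp [FrecR, z, mul_assoc]
  refine ⟨y, hy, ?_⟩
  rw [Hfun, hfun, hF]
  calc _ ≤ (1 - β * γ) * √(fd β γ lam (s.1 + s.2.1 + s.2.2) y /
          ((β * fd β γ lam (s.1 + s.2.1 + s.2.2) y + 1) *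
            (fd β γ lam (s.1 + s.2.1 + s.2.2) y + γ))) *
        (((s.1 + s.2.1 + s.2.2 : ℕ) : ℝ) * √(y / ((β * y + 1) * (y + γ)))) := by
        gcongr
    _ = _ := by ring
end
end
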